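/- For a short exact sequence 0 → A₁ → A₂ → A₃ → 0 of abelian groups, the following are equivalent: (1) for every abelian group A, the induced map Ext¹(A₃, A) → Ext¹(A₂, A) is injective; (2) the short exact sequence splits. -/

import Mathlib

open CategoryTheory

/-- If `ψ : K ⟶ L` is epi on homology in degree `i` and `T` is injective, then an opcycle
`k : L.X i ⟶ T` whose pullback to `K` extends along the differential itself extends along the
differential. -/
lemma exists_eq_d_comp_of_epi_homologyMap {D ι : Type*} [Category* D] [Abelian D]
    {c : ComplexShape ι} {K L : HomologicalComplex D c} (ψ : K ⟶ L) (h i j : ι)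
    (hh : c.prev i = h) (hj : c.next i = j) [Epi (HomologicalComplex.homologyMap ψ i)]
    {T : D} [Injective T] (k : L.X i ⟶ T) (hk : L.d h i ≫ k = 0)
    (t : K.X j ⟶ T) (ht : ψ.f i ≫ k = K.d i j ≫ t) :
    ∃ e : L.X j ⟶ T, k = L.d i j ≫ e := by
  have hz : L.homologyι i ≫ L.descOpcycles k h hh hk = 0 := by
    rw [← cancel_epi (HomologicalComplex.homologyMap ψ i), Limits.comp_zero,
      HomologicalComplex.homologyι_naturality_assoc]
    convert K.homologyι_descOpcycles_eq_zero_of_boundary (ψ.f i ≫ k) h hh t ht using 2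
    simp
  have hex : (ShortComplex.mk _ _ (L.homologyι_comp_fromOpcycles i j)).Exact :=
    ShortComplex.exact_of_f_is_kernel _ (L.homologyIsKernel i j hj)
  refine ⟨hex.descToInjective _ hz, ?_⟩
  have := hex.comp_descToInjective _ hz
  dsimp only at this
  rw [← L.p_fromOpcycles, Category.assoc, this, L.p_descOpcycles]

/-- If `Ext¹(Y, A) → Ext¹(X, A)` is injective, then a `1`-cocycle of a projective resolution of `Y`
with values in `A` is a coboundary as soon as its pullback to a projective resolution of `X` is. -/
lemma exists_eq_d_comp_of_injective_ext_map.{u, v} {R : Type v} [Ring R] {C : Type u}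
    [Category.{v} C] [Abelian C] [Linear R C] [EnoughProjectives C] {X Y A : C} (f : X ⟶ Y)
    (P : ProjectiveResolution X) (Q : ProjectiveResolution Y) (φ : P.complex ⟶ Q.complex)
    (comm : φ.f 0 ≫ Q.π.f 0 = P.π.f 0 ≫ f)
    (hinj : Function.Injective ⇑(((Ext R C 1).map f.op).app A))
    (c : Q.complex.X 1 ⟶ A) (hc : Q.complex.d 2 1 ≫ c = 0)
    (b : P.complex.X 0 ⟶ A) (hb : φ.f 1 ≫ c = P.complex.d 1 0 ≫ b) :
    ∃ e : Q.complex.X 0 ⟶ A, c = Q.complex.d 1 0 ≫ e := by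
  let F := ((linearYoneda R C).obj A).rightOp
  have hmono : Mono ((F.leftDerived 1).map f).unop := (ModuleCat.mono_iff_injective _).2 hinj
  have hepi : Epi ((F.leftDerived 1).map f) := unop_mono_iff _ |>.1 hmono
  have hnat := P.isoLeftDerivedObj_hom_naturality f Q φ comm F 1
  have : Epi (HomologicalComplex.homologyMap ((F.mapHomologicalComplex _).map φ) 1) := by
    have h : Epi ((P.isoLeftDerivedObj F 1).hom ≫
        (F.mapHomologicalComplex _ ⋙ HomologicalComplex.homologyFunctor _ _ 1).map φ) := by
      rw [← hnat]
      exact epi_comp _ _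
    exact @epi_of_epi _ _ _ _ _ (P.isoLeftDerivedObj F 1).hom _ h
  let val {Z : C} (g : Z ⟶ A) : F.obj Z ⟶ Opposite.op (ModuleCat.of R R) :=
    (ModuleCat.ofHom (LinearMap.toSpanSingleton R (Z ⟶ A) g)).op
  have hval {Z W : C} (g : W ⟶ Z) (a : Z ⟶ A) : F.map g ≫ val a = val (g ≫ a) := by
    apply Quiver.Hom.unop_inj
    ext
    change g ≫ ((1 : R) • a) = (1 : R) • (g ≫ a)
    simp
  obtain ⟨e, he⟩ := exists_eq_d_comp_of_epi_homologyMap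
    ((F.mapHomologicalComplex _).map φ) 2 1 0 (by simp) (by simp) (val c)
    ((hval _ _).trans (by rw [hc]; simp [val]; rfl)) (val b)
    ((hval _ _).trans ((congrArg val hb).trans (hval _ _).symm))
  refine ⟨e.unop.hom (1 : R), ?_⟩
  have h1 : (1 : R) • c = Q.complex.d 1 0 ≫ e.unop.hom (1 : R) :=
    congrArg (fun m ↦ m.unop.hom (1 : R)) he
  rwa [one_smul] at h1

/-- For a short exact sequence `0 → A₁ → A₂ → A₃ → 0` of abelian groups, the map
`Ext¹(A₃, A) → Ext¹(A₂, A)` is injective for every abelian group `A` iff the sequence splits. -/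
theorem stmt1 (A₁ A₂ A₃ : ModuleCat.{0} ℤ) (i : A₁ ⟶ A₂) (p : A₂ ⟶ A₃)
    (hi : Function.Injective i) (hp : Function.Surjective p) (hip : Function.Exact i p) :
    (∀ A : ModuleCat.{0} ℤ,
        Function.Injective ⇑(((Ext ℤ (ModuleCat.{0} ℤ) 1).map p.op).app A)) ↔
      ∃ s : A₃ ⟶ A₂, s ≫ p = 𝟙 A₃ := by
  constructor
  · intro h
    have : Mono i := (ModuleCat.mono_iff_injective _).2 hi
    have : Epi p := (ModuleCat.epi_iff_surjective _).2 hp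
    have w : i ≫ p = 0 := by ext x; exact hip.apply_apply_eq_zero x
    have hS : (ShortComplex.mk i p w).Exact :=
      (ShortComplex.ShortExact.moduleCat_exact_iff_function_exact _).2 hip
    let P := projectiveResolution A₂
    let Q := projectiveResolution A₃
    let φ := ProjectiveResolution.lift p P Q
    have comm : φ.f 0 ≫ Q.π.f 0 = P.π.f 0 ≫ p := ProjectiveResolution.lift_commutes_zero p P Q
    let π : Q.complex.X 0 ⟶ A₃ := Q.π.f 0
    let ρ : P.complex.X 0 ⟶ A₂ := P.π.f 0
    have hπ : Q.complex.d 1 0 ≫ π = 0 := Q.complex_d_comp_π_f_zero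
    have hρ : P.complex.d 1 0 ≫ ρ = 0 := P.complex_d_comp_π_f_zero
    have comm' : φ.f 0 ≫ π = ρ ≫ p := comm
    have : Epi π := inferInstanceAs (Epi (Q.π.f 0))
    obtain ⟨g, hg⟩ : ∃ g : Q.complex.X 0 ⟶ A₂, g ≫ p = π :=
      ⟨Projective.factorThru π p, Projective.factorThru_comp π p⟩
    obtain ⟨c, hc⟩ : ∃ c : Q.complex.X 1 ⟶ A₁, c ≫ i = Q.complex.d 1 0 ≫ g :=
      ⟨hS.lift _ (by simp [hg, hπ]), hS.lift_f _ _⟩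
    obtain ⟨b, hb⟩ : ∃ b : P.complex.X 0 ⟶ A₁, b ≫ i = φ.f 0 ≫ g - ρ :=
      ⟨hS.lift _ (by simp [hg, comm']), hS.lift_f _ _⟩
    obtain ⟨e, he⟩ := exists_eq_d_comp_of_injective_ext_map p P Q φ comm (h A₁) c
      (by simp [← cancel_mono i, hc]) b
      (by simp [← cancel_mono i, hc, hb, hρ])
    have hex : (ShortComplex.mk (Q.complex.d 1 0) π hπ).Exact := Q.exact₀
    obtain ⟨s, hs⟩ : ∃ s : A₃ ⟶ A₂, π ≫ s = g - e ≫ i :=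
      ⟨hex.desc _ (by simp [← hc, he]), hex.g_desc _ _⟩
    refine ⟨s, ?_⟩
    rw [← cancel_epi π, reassoc_of% hs]
    simp [hg, w]
  · rintro ⟨s, hs⟩ A
    refine Function.LeftInverse.injective (g := ((Ext ℤ (ModuleCat.{0} ℤ) 1).map s.op).app A) ?_
    intro x
    rw [← ConcreteCategory.comp_apply, ← NatTrans.comp_app, ← Functor.map_comp, ← op_comp, hs]
    simp
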